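/- Suppose moreover that A_{i,n+1}·A_{n+1,i} ≥ 4 for all 1 ≤ i ≤ n. Let i_1, …, i_r ∈ {1, …, n} be indices such that ℓ(s_{i_r}⋯s_{i_1}) = r. Then s_{i_r}⋯s_{i_1}(α_{n+1}) is a positive expression: for every 1 ≤ k ≤ r, s_{i_k}s_{i_{k−1}}⋯s_{i_1}(α_{n+1}) − s_{i_{k−1}}⋯s_{i_1}(α_{n+1}) ∈ ℝ_{>0}·α_{i_k}; in particular β := s_{i_r}⋯s_{i_1}(α_{n+1}) is a positive root. -/

import Mathlib

/-!
Setup: a symmetrizable crystallographic Cartan matrix `A` with symmetrizers `d`,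
the vector space `V = Fin n → ℝ` with standard basis `α i = Pi.single i 1`,
the bilinear form `(α i, α j) = d i * A i j`, the simple reflections
`s i (x) = x - (dᵢ⁻¹ αᵢ, x) αᵢ`, the group `W` generated by them (elements of
which are represented as products of lists of simple reflections), and the
set of real roots `Φ = { w (α i) }`.
-/

open Finset

noncomputable section

/-- The simple root `α i`, i.e. the `i`-th standard basis vector of `ℝⁿ`. -/
def sroot (n : ℕ) (i : Fin n) : Fin n → ℝ := Pi.single i 1

/-- The symmetric bilinear form with `(α i, α j) = d i * A i j`. -/
def formL (n : ℕ) (d : Fin n → ℤ) (A : Fin n → Fin n → ℤ) :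
    (Fin n → ℝ) →ₗ[ℝ] (Fin n → ℝ) →ₗ[ℝ] ℝ :=
  ∑ i : Fin n, ∑ j : Fin n,
    ((d i * A i j : ℤ) : ℝ) •
      LinearMap.smulRight (LinearMap.proj i : (Fin n → ℝ) →ₗ[ℝ] ℝ)
        (LinearMap.proj j : (Fin n → ℝ) →ₗ[ℝ] ℝ)

/-- The simple reflection `s i`, given by `s i x = x - (dᵢ⁻¹ • αᵢ, x) • αᵢ`. -/
def simpleRefl (n : ℕ) (d : Fin n → ℤ) (A : Fin n → Fin n → ℤ) (i : Fin n) :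
    Module.End ℝ (Fin n → ℝ) :=
  LinearMap.id - ((d i : ℝ)⁻¹) • (formL n d A (sroot n i)).smulRight (sroot n i)

/-- The element `s i_r * ⋯ * s i_1` of `W` corresponding to the list `l = [i_1, …, i_r]`
(the reflection `s i_1` is applied first). -/
def wprod (n : ℕ) (d : Fin n → ℤ) (A : Fin n → Fin n → ℤ) (l : List (Fin n)) :
    Module.End ℝ (Fin n → ℝ) :=
  ((l.map (simpleRefl n d A)).reverse).prod

/-- `β` is a real root: `β = w (α i)` for some `w ∈ W` and some `i`. -/
def IsRoot (n : ℕ) (d : Fin n → ℤ) (A : Fin n → Fin n → ℤ) (β : Fin n → ℝ) : Prop :=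
  ∃ (l : List (Fin n)) (i : Fin n), β = wprod n d A l (sroot n i)

/-- `β` is a positive root: a real root all of whose coordinates are `≥ 0`. -/
def IsPosRoot (n : ℕ) (d : Fin n → ℤ) (A : Fin n → Fin n → ℤ) (β : Fin n → ℝ) : Prop :=
  IsRoot n d A β ∧ ∀ k, 0 ≤ β k

/-- `β` is a negative root: a real root all of whose coordinates are `≤ 0`. -/
def IsNegRoot (n : ℕ) (d : Fin n → ℤ) (A : Fin n → Fin n → ℤ) (β : Fin n → ℝ) : Prop :=
  IsRoot n d A β ∧ ∀ k, β k ≤ 0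

/-- The reflection `t_β` along a root `β`: `t_β x = x - (β^∨, x) • β` where
`β^∨ = d_β⁻¹ • β` and `d_β = (β, β)/2`. -/
def reflAlong (n : ℕ) (d : Fin n → ℤ) (A : Fin n → Fin n → ℤ) (β : Fin n → ℝ) :
    Module.End ℝ (Fin n → ℝ) :=
  LinearMap.id - (2 / formL n d A β β) • (formL n d A β).smulRight β

/-- `s i_r ⋯ s i_1 (α j)` (encoded by the list `l = [i_1, …, i_r]` and the index `j`)
is a positive expression: each partial application moves up in the root poset, i.e.
`s i_k ⋯ s i_1 (α j) - s i_{k-1} ⋯ s i_1 (α j) ∈ ℝ_{>0} • α i_k` for all `k`. -/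
def IsPosExpr (n : ℕ) (d : Fin n → ℤ) (A : Fin n → Fin n → ℤ) (j : Fin n)
    (l : List (Fin n)) : Prop :=
  ∀ k : Fin l.length, ∃ c : ℝ, 0 < c ∧
    wprod n d A (l.take (k.1 + 1)) (sroot n j) - wprod n d A (l.take k.1) (sroot n j)
      = c • sroot n (l.get k)

/-- The length `ℓ(w)`: the smallest `r` such that `w` is a product of `r` simple
reflections. -/
def len (n : ℕ) (d : Fin n → ℤ) (A : Fin n → Fin n → ℤ)
    (w : Module.End ℝ (Fin n → ℝ)) : ℕ :=
  sInf {r | ∃ l : List (Fin n), l.length = r ∧ wprod n d A l = w}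

def coF (n : ℕ) (d : Fin n → ℤ) (A : Fin n → Fin n → ℤ) (i : Fin n) :
    (Fin n → ℝ) →ₗ[ℝ] ℝ := ((d i : ℝ)⁻¹) • (formL n d A (sroot n i))

lemma refl_apply (n : ℕ) (d : Fin n → ℤ) (A : Fin n → Fin n → ℤ) (i : Fin n)
    (x : Fin n → ℝ) : simpleRefl n d A i x = x - coF n d A i x • sroot n i := by
  simp [simpleRefl, coF, smul_smul]

lemma formL_apply (n : ℕ) (d : Fin n → ℤ) (A : Fin n → Fin n → ℤ) (x y : Fin n → ℝ) :
    formL n d A x y = ∑ i, ∑ j, ((d i * A i j : ℤ) : ℝ) * (x i * y j) := by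
  simp [formL, LinearMap.sum_apply]

lemma formL_sroot (n : ℕ) (d : Fin n → ℤ) (A : Fin n → Fin n → ℤ) (i j : Fin n) :
    formL n d A (sroot n i) (sroot n j) = ((d i * A i j : ℤ) : ℝ) := by
  rw [formL_apply]
  simp [sroot, Pi.single_apply]

lemma formL_symm (n : ℕ) (d : Fin n → ℤ) (A : Fin n → Fin n → ℤ)
    (hsym : ∀ i j, d i * A i j = d j * A j i) (x y : Fin n → ℝ) :
    formL n d A x y = formL n d A y x := by
  rw [formL_apply, formL_apply, Finset.sum_comm]
  refine Finset.sum_congr rfl fun i _ => Finset.sum_congr rfl fun j _ => ?_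
  rw [hsym j i]; ring

lemma coF_sroot (n : ℕ) (d : Fin n → ℤ) (A : Fin n → Fin n → ℤ) (hd : ∀ i, 0 < d i)
    (i j : Fin n) : coF n d A i (sroot n j) = A i j := by
  have : (d i : ℝ) ≠ 0 := by exact_mod_cast (hd i).ne'
  simp [coF, formL_sroot]
  field_simp

/-- left to right product -/
def LP (n : ℕ) (d : Fin n → ℤ) (A : Fin n → Fin n → ℤ) (l : List (Fin n)) :
    Module.End ℝ (Fin n → ℝ) := (l.map (simpleRefl n d A)).prod

section
variable {n : ℕ} {d : Fin n → ℤ} {A : Fin n → Fin n → ℤ}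

lemma LP_nil : LP n d A [] = 1 := rfl
lemma LP_cons (i : Fin n) (l : List (Fin n)) :
    LP n d A (i :: l) = simpleRefl n d A i * LP n d A l := by simp [LP]
lemma LP_append (l l' : List (Fin n)) :
    LP n d A (l ++ l') = LP n d A l * LP n d A l' := by simp [LP]

lemma refl_sq (hd : ∀ i, 0 < d i) (hdiag : ∀ i, A i i = 2) (i : Fin n) :
    simpleRefl n d A i * simpleRefl n d A i = 1 := by
  ext1 x
  rw [LinearMap.ext_iff]
  intro y
  simp only [LinearMap.comp_apply, Module.End.mul_apply, refl_apply, map_sub, map_smul,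
    coF_sroot n d A hd, hdiag, Module.End.one_apply]
  push_cast
  module

def Red (n : ℕ) (d : Fin n → ℤ) (A : Fin n → Fin n → ℤ) (l : List (Fin n)) : Prop :=
  ∀ l', LP n d A l' = LP n d A l → l.length ≤ l'.length

def Asc (n : ℕ) (d : Fin n → ℤ) (A : Fin n → Fin n → ℤ) (l : List (Fin n)) (i : Fin n) : Prop :=
  ∀ l', LP n d A l' = LP n d A l * simpleRefl n d A i → l.length ≤ l'.length

/-- alternating word of length k ending in j -/
def alt (i j : Fin n) : ℕ → List (Fin n)
  | 0 => []
  | k + 1 => (if k % 2 = 0 then j else i) :: alt i j k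

lemma alt_length (i j : Fin n) (k : ℕ) : (alt i j k).length = k := by
  induction k with
  | zero => rfl
  | succ k ih => simp [alt, ih]

lemma Red.suffix {v u : List (Fin n)} (h : Red n d A (v ++ u)) : Red n d A u := by
  intro l' hl'
  have := h (v ++ l') (by rw [LP_append, LP_append, hl'])
  simp at this; omega

lemma Red.pre {v u : List (Fin n)} (h : Red n d A (v ++ u)) : Red n d A v := by
  intro l' hl'
  have := h (l' ++ u) (by rw [LP_append, LP_append, hl'])
  simp at this; omega

lemma Asc.suffix {v u : List (Fin n)} {i : Fin n} (h : Asc n d A (v ++ u) i) :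
    Asc n d A u i := by
  intro l' hl'
  have := h (v ++ l') (by rw [LP_append, LP_append, hl', mul_assoc])
  simp at this; omega

lemma eq_alt (hd : ∀ i, 0 < d i) (hdiag : ∀ i, A i i = 2) {i j : Fin n} (u : List (Fin n))
    (hu : ∀ c ∈ u, c = i ∨ c = j) (hr : Red n d A u) (ha : Asc n d A u i) :
    u = alt i j u.length := by
  induction u with
  | nil => rfl
  | cons c u ih =>
    have hr' : Red n d A u := Red.suffix (v := [c]) hr
    have ha' : Asc n d A u i := Asc.suffix (v := [c]) ha
    have e := ih (fun c hc => hu c (by simp [hc])) hr' ha'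
    have key : c = (if u.length % 2 = 0 then j else i) := by
      rcases hk : u.length with _ | k
      · have hn : u = [] := by simpa using hk
        subst hn
        simp
        rcases hu c (by simp) with h | h
        · subst h
          have := ha [] (by rw [LP_cons, LP_nil, mul_one, refl_sq hd hdiag])
          simp at this
        · exact h
      · rw [hk] at e
        by_contra hne
        have hc := hu c (by simp)
        have hc2 : c = (if k % 2 = 0 then j else i) := by
          rcases Nat.mod_two_eq_zero_or_one k with h | h
          · have h2 : (k + 1) % 2 = 1 := by omega
            simp [h, h2] at hne ⊢; tauto
          · have h2 : (k + 1) % 2 = 0 := by omega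
            simp [h, h2] at hne ⊢; tauto
        have := hr (alt i j k) (by
          rw [e, LP_cons, alt, LP_cons, ← hc2, ← mul_assoc, refl_sq hd hdiag, one_mul])
        rw [alt_length] at this
        simp at this; omega
    rw [List.length_cons, alt, ← key, ← e]

lemma alt_ge4 (hd : ∀ i, 0 < d i) (hdiag : ∀ i, A i i = 2) {i j : Fin n}
    (hij : A i j ≤ 0) (hji : A j i ≤ 0) (h4 : 4 ≤ A i j * A j i) (k : ℕ) :
    ∃ p q : ℝ, 0 ≤ p ∧ 0 ≤ q ∧ LP n d A (alt i j k) (sroot n i) = p • sroot n i + q • sroot n j ∧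
      (if k % 2 = 0 then 2 * q ≤ -(A j i : ℝ) * p else 2 * p ≤ -(A i j : ℝ) * q) := by
  have h1 : (A i j : ℝ) ≤ 0 := by exact_mod_cast hij
  have h2 : (A j i : ℝ) ≤ 0 := by exact_mod_cast hji
  have h3 : (4 : ℝ) ≤ A i j * A j i := by exact_mod_cast h4
  induction k with
  | zero => exact ⟨1, 0, by simp, by simp, by simp [alt, LP_nil], by simp [h2]⟩
  | succ k ih =>
    obtain ⟨p, q, hp, hq, e, hc⟩ := ih
    rcases Nat.mod_two_eq_zero_or_one k with h | h
    · have h' : (k + 1) % 2 = 1 := by omega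
      simp only [h, if_true] at hc
      refine ⟨p, -(A j i : ℝ) * p - q, hp, by linarith, ?_, ?_⟩
      · rw [alt, LP_cons, Module.End.mul_apply, e]
        simp only [h, if_true, refl_apply, map_add, map_smul, coF_sroot n d A hd, hdiag]
        push_cast
        module
      · simp only [h', one_ne_zero, if_false]
        nlinarith [mul_le_mul_of_nonneg_left hc (neg_nonneg.2 h1), mul_le_mul_of_nonneg_right h3 hp]
    · have h' : (k + 1) % 2 = 0 := by omega
      simp only [h, one_ne_zero, if_false] at hc
      refine ⟨-(A i j : ℝ) * q - p, q, by linarith, hq, ?_, ?_⟩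
      · rw [alt, LP_cons, Module.End.mul_apply, e]
        simp only [h, one_ne_zero, if_false, refl_apply, map_add, map_smul, coF_sroot n d A hd, hdiag]
        push_cast
        module
      · simp only [h', if_true]
        nlinarith [mul_le_mul_of_nonneg_left hc (neg_nonneg.2 h2), mul_le_mul_of_nonneg_right h3 hq]

lemma refl_i (hd : ∀ i, 0 < d i) (hdiag : ∀ i, A i i = 2) {i j : Fin n} (a : ℤ) (ha : A i j = a)
    (x : Fin n → ℝ) (p q : ℝ) :
    simpleRefl n d A i (x + p • sroot n i + q • sroot n j) =
      x + (-p - coF n d A i x - a * q) • sroot n i + q • sroot n j := by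
  simp only [refl_apply, map_add, map_smul, coF_sroot n d A hd, hdiag, ha]
  push_cast
  module

lemma refl_j (hd : ∀ i, 0 < d i) (hdiag : ∀ i, A i i = 2) {i j : Fin n} (a : ℤ) (ha : A j i = a)
    (x : Fin n → ℝ) (p q : ℝ) :
    simpleRefl n d A j (x + p • sroot n i + q • sroot n j) =
      x + p • sroot n i + (-q - coF n d A j x - a * p) • sroot n j := by
  simp only [refl_apply, map_add, map_smul, coF_sroot n d A hd, hdiag, ha]
  push_cast
  module

set_option maxHeartbeats 1000000 in
/-- finite dihedral case: braid relation and positivity -/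
lemma alt_fin (hd : ∀ i, 0 < d i) (hdiag : ∀ i, A i i = 2) {i j : Fin n}
    (h : (A i j = 0 ∧ A j i = 0) ∨ (A i j = -1 ∧ A j i = -1) ∨ (A i j = -1 ∧ A j i = -2) ∨
      (A i j = -2 ∧ A j i = -1) ∨ (A i j = -1 ∧ A j i = -3) ∨ (A i j = -3 ∧ A j i = -1)) :
    ∃ m : ℕ, (∃ l', l'.length < m ∧
        LP n d A l' = LP n d A (alt i j m) * simpleRefl n d A i) ∧
      ∀ k < m, ∃ p q : ℝ, 0 ≤ p ∧ 0 ≤ q ∧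
        LP n d A (alt i j k) (sroot n i) = p • sroot n i + q • sroot n j := by
  have ci : ∀ a : ℤ, A i j = a → ∀ p q : ℝ, simpleRefl n d A i (p • sroot n i + q • sroot n j) =
      (-p - a * q) • sroot n i + q • sroot n j := by
    intro a ha p q
    have := refl_i hd hdiag a ha 0 p q
    simpa using this
  have cj : ∀ a : ℤ, A j i = a → ∀ p q : ℝ, simpleRefl n d A j (p • sroot n i + q • sroot n j) =
      p • sroot n i + (-q - a * p) • sroot n j := by
    intro a ha p q
    have := refl_j hd hdiag a ha 0 p q
    simpa using this
  have e0 : sroot n i = (1:ℝ) • sroot n i + (0:ℝ) • sroot n j := by simp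
  have ex : ∀ x : Fin n → ℝ, x = x + (0:ℝ) • sroot n i + (0:ℝ) • sroot n j := by simp
  rcases h with ⟨h1, h2⟩ | ⟨h1, h2⟩ | ⟨h1, h2⟩ | ⟨h1, h2⟩ | ⟨h1, h2⟩ | ⟨h1, h2⟩
  · refine ⟨2, ⟨alt i j 1, by simp [alt_length], ?_⟩, ?_⟩
    · rw [LinearMap.ext_iff]
      intro x
      rw [ex x]
      simp only [alt, LP_cons, LP_nil, Module.End.mul_apply, Module.End.one_apply,
        Nat.zero_mod, if_true, Nat.reduceMod, Nat.reduceAdd, one_ne_zero, if_false,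
        refl_i hd hdiag _ h1, refl_j hd hdiag _ h2]
      push_cast
      module
    · intro k hk
      suffices hs : ∃ p q : ℝ, 0 ≤ p ∧ 0 ≤ q ∧
          LP n d A (alt i j k) ((1:ℝ) • sroot n i + (0:ℝ) • sroot n j) =
            p • sroot n i + q • sroot n j by rwa [← e0] at hs
      interval_cases k <;>
      simp only [alt, LP_cons, LP_nil, Module.End.mul_apply, Module.End.one_apply,
        Nat.zero_mod, if_true, Nat.reduceMod, Nat.reduceAdd, one_ne_zero, if_false,
        ci _ h1, cj _ h2] <;>
      refine ⟨_, _, ?_, ?_, rfl⟩ <;> norm_num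
  · refine ⟨3, ⟨alt i j 2, by simp [alt_length], ?_⟩, ?_⟩
    · rw [LinearMap.ext_iff]
      intro x
      rw [ex x]
      simp only [alt, LP_cons, LP_nil, Module.End.mul_apply, Module.End.one_apply,
        Nat.zero_mod, if_true, Nat.reduceMod, Nat.reduceAdd, one_ne_zero, if_false,
        refl_i hd hdiag _ h1, refl_j hd hdiag _ h2]
      push_cast
      module
    · intro k hk
      suffices hs : ∃ p q : ℝ, 0 ≤ p ∧ 0 ≤ q ∧
          LP n d A (alt i j k) ((1:ℝ) • sroot n i + (0:ℝ) • sroot n j) =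
            p • sroot n i + q • sroot n j by rwa [← e0] at hs
      interval_cases k <;>
      simp only [alt, LP_cons, LP_nil, Module.End.mul_apply, Module.End.one_apply,
        Nat.zero_mod, if_true, Nat.reduceMod, Nat.reduceAdd, one_ne_zero, if_false,
        ci _ h1, cj _ h2] <;>
      refine ⟨_, _, ?_, ?_, rfl⟩ <;> norm_num
  · refine ⟨4, ⟨alt i j 3, by simp [alt_length], ?_⟩, ?_⟩
    · rw [LinearMap.ext_iff]
      intro x
      rw [ex x]
      simp only [alt, LP_cons, LP_nil, Module.End.mul_apply, Module.End.one_apply,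
        Nat.zero_mod, if_true, Nat.reduceMod, Nat.reduceAdd, one_ne_zero, if_false,
        refl_i hd hdiag _ h1, refl_j hd hdiag _ h2]
      push_cast
      module
    · intro k hk
      suffices hs : ∃ p q : ℝ, 0 ≤ p ∧ 0 ≤ q ∧
          LP n d A (alt i j k) ((1:ℝ) • sroot n i + (0:ℝ) • sroot n j) =
            p • sroot n i + q • sroot n j by rwa [← e0] at hs
      interval_cases k <;>
      simp only [alt, LP_cons, LP_nil, Module.End.mul_apply, Module.End.one_apply,
        Nat.zero_mod, if_true, Nat.reduceMod, Nat.reduceAdd, one_ne_zero, if_false,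
        ci _ h1, cj _ h2] <;>
      refine ⟨_, _, ?_, ?_, rfl⟩ <;> norm_num
  · refine ⟨4, ⟨alt i j 3, by simp [alt_length], ?_⟩, ?_⟩
    · rw [LinearMap.ext_iff]
      intro x
      rw [ex x]
      simp only [alt, LP_cons, LP_nil, Module.End.mul_apply, Module.End.one_apply,
        Nat.zero_mod, if_true, Nat.reduceMod, Nat.reduceAdd, one_ne_zero, if_false,
        refl_i hd hdiag _ h1, refl_j hd hdiag _ h2]
      push_cast
      module
    · intro k hk
      suffices hs : ∃ p q : ℝ, 0 ≤ p ∧ 0 ≤ q ∧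
          LP n d A (alt i j k) ((1:ℝ) • sroot n i + (0:ℝ) • sroot n j) =
            p • sroot n i + q • sroot n j by rwa [← e0] at hs
      interval_cases k <;>
      simp only [alt, LP_cons, LP_nil, Module.End.mul_apply, Module.End.one_apply,
        Nat.zero_mod, if_true, Nat.reduceMod, Nat.reduceAdd, one_ne_zero, if_false,
        ci _ h1, cj _ h2] <;>
      refine ⟨_, _, ?_, ?_, rfl⟩ <;> norm_num
  · refine ⟨6, ⟨alt i j 5, by simp [alt_length], ?_⟩, ?_⟩
    · rw [LinearMap.ext_iff]
      intro x
      rw [ex x]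
      simp only [alt, LP_cons, LP_nil, Module.End.mul_apply, Module.End.one_apply,
        Nat.zero_mod, if_true, Nat.reduceMod, Nat.reduceAdd, one_ne_zero, if_false,
        refl_i hd hdiag _ h1, refl_j hd hdiag _ h2]
      push_cast
      module
    · intro k hk
      suffices hs : ∃ p q : ℝ, 0 ≤ p ∧ 0 ≤ q ∧
          LP n d A (alt i j k) ((1:ℝ) • sroot n i + (0:ℝ) • sroot n j) =
            p • sroot n i + q • sroot n j by rwa [← e0] at hs
      interval_cases k <;>
      simp only [alt, LP_cons, LP_nil, Module.End.mul_apply, Module.End.one_apply,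
        Nat.zero_mod, if_true, Nat.reduceMod, Nat.reduceAdd, one_ne_zero, if_false,
        ci _ h1, cj _ h2] <;>
      refine ⟨_, _, ?_, ?_, rfl⟩ <;> norm_num
  · refine ⟨6, ⟨alt i j 5, by simp [alt_length], ?_⟩, ?_⟩
    · rw [LinearMap.ext_iff]
      intro x
      rw [ex x]
      simp only [alt, LP_cons, LP_nil, Module.End.mul_apply, Module.End.one_apply,
        Nat.zero_mod, if_true, Nat.reduceMod, Nat.reduceAdd, one_ne_zero, if_false,
        refl_i hd hdiag _ h1, refl_j hd hdiag _ h2]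
      push_cast
      module
    · intro k hk
      suffices hs : ∃ p q : ℝ, 0 ≤ p ∧ 0 ≤ q ∧
          LP n d A (alt i j k) ((1:ℝ) • sroot n i + (0:ℝ) • sroot n j) =
            p • sroot n i + q • sroot n j by rwa [← e0] at hs
      interval_cases k <;>
      simp only [alt, LP_cons, LP_nil, Module.End.mul_apply, Module.End.one_apply,
        Nat.zero_mod, if_true, Nat.reduceMod, Nat.reduceAdd, one_ne_zero, if_false,
        ci _ h1, cj _ h2] <;>
      refine ⟨_, _, ?_, ?_, rfl⟩ <;> norm_num

lemma rank2 (hd : ∀ i, 0 < d i) (hdiag : ∀ i, A i i = 2)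
    (hoff : ∀ i j, i ≠ j → A i j ≤ 0)
    (hsym : ∀ i j, d i * A i j = d j * A j i) {i j : Fin n} (hij : i ≠ j) (u : List (Fin n))
    (hu : ∀ c ∈ u, c = i ∨ c = j) (hr : Red n d A u) (ha : Asc n d A u i) :
    ∃ p q : ℝ, 0 ≤ p ∧ 0 ≤ q ∧
        LP n d A u (sroot n i) = p • sroot n i + q • sroot n j := by
  have h1 := hoff i j hij
  have h2 := hoff j i hij.symm
  by_cases h4 : 4 ≤ A i j * A j i
  · obtain ⟨p, q, hp, hq, e, -⟩ := alt_ge4 hd hdiag h1 h2 h4 u.length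
    rw [← eq_alt hd hdiag u hu hr ha] at e
    exact ⟨p, q, hp, hq, e⟩
  · have hz : A i j = 0 ↔ A j i = 0 := by
      have := hsym i j
      constructor <;> intro h <;> simp [h, (hd i).ne', (hd j).ne'] at this <;> exact this
    have cases : (A i j = 0 ∧ A j i = 0) ∨ (A i j = -1 ∧ A j i = -1) ∨ (A i j = -1 ∧ A j i = -2) ∨
      (A i j = -2 ∧ A j i = -1) ∨ (A i j = -1 ∧ A j i = -3) ∨ (A i j = -3 ∧ A j i = -1) := by
      by_cases h0 : A i j = 0
      · left; exact ⟨h0, hz.1 h0⟩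
      · have h0' : A j i ≠ 0 := fun h => h0 (hz.2 h)
        have g1 : A i j ≤ -1 := by omega
        have g2 : A j i ≤ -1 := by omega
        have g3 : -3 ≤ A i j := by nlinarith
        have g4 : -3 ≤ A j i := by nlinarith
        generalize A i j = a at *
        generalize A j i = b at *
        interval_cases a <;> interval_cases b <;> simp_all
    obtain ⟨m, ⟨l', hl', e'⟩, hk⟩ := alt_fin hd hdiag cases
    by_cases hm : u.length < m
    · have := hk _ hm
      rwa [← eq_alt hd hdiag u hu hr ha] at this
    · exfalso
      -- the suffix of length m
      have hs : u = u.take (u.length - m) ++ u.drop (u.length - m) := by simp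
      have hlen : (u.drop (u.length - m)).length = m := by simp; omega
      rw [hs] at hr ha
      have e := eq_alt hd hdiag (u.drop (u.length - m))
        (fun c hc => hu c (List.mem_of_mem_drop hc)) hr.suffix ha.suffix
      rw [hlen] at e
      have := ha.suffix l' (by rw [e', ← e])
      omega

lemma tits (hd : ∀ i, 0 < d i) (hdiag : ∀ i, A i i = 2)
    (hoff : ∀ i j, i ≠ j → A i j ≤ 0)
    (hsym : ∀ i j, d i * A i j = d j * A j i) (r : ℕ) : ∀ (l : List (Fin n)) (i : Fin n),
    l.length = r → Red n d A l → Asc n d A l i → ∀ k, 0 ≤ LP n d A l (sroot n i) k := by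
  induction r using Nat.strong_induction_on with
  | _ r ih =>
  intro l i hlr hr ha
  rcases List.eq_nil_or_concat' l with rfl | ⟨l0, j, rfl⟩
  · intro k
    simp only [LP_nil, Module.End.one_apply, sroot, Pi.single_apply]
    split <;> simp
  have hij : i ≠ j := by
    rintro rfl
    have := ha l0 (by rw [LP_append, LP_cons, LP_nil, mul_one, mul_assoc, refl_sq hd hdiag, mul_one])
    simp at this
  classical
  let Q : ℕ → Prop := fun m => ∃ v u : List (Fin n), v.length = m ∧ m + u.length = r ∧
    LP n d A (v ++ u) = LP n d A (l0 ++ [j]) ∧ ∀ c ∈ u, c = i ∨ c = j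
  have hQ0 : Q l0.length := ⟨l0, [j], rfl, by simpa using hlr, rfl, by simp⟩
  have hQ : ∃ m, Q m := ⟨_, hQ0⟩
  obtain ⟨v, u, hv, hvu, e, hu⟩ := Nat.find_spec hQ
  have hmin := fun m (hm : m < Nat.find hQ) => Nat.find_min hQ hm
  have hle : Nat.find hQ ≤ l0.length := Nat.find_min' hQ hQ0
  rw [← hv] at hmin hle hvu
  have hr2 : Red n d A (v ++ u) := by
    intro l' hl'
    have := hr l' (hl'.trans e)
    simp at this hlr ⊢; omega
  have ha2 : Asc n d A (v ++ u) i := by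
    intro l' hl'
    have := ha l' (by rw [hl', e])
    simp at this hlr ⊢; omega
  have hasc : ∀ c, (c = i ∨ c = j) → Asc n d A v c := by
    intro c hc v' hv'
    by_contra hlt
    have e2 : LP n d A (v' ++ c :: u) = LP n d A (v ++ u) := by
      rw [LP_append, LP_cons, hv', LP_append, mul_assoc, ← mul_assoc (simpleRefl n d A c),
        refl_sq hd hdiag, one_mul]
    have := hr2 _ e2
    simp at this
    refine hmin v'.length (by omega) ⟨v', c :: u, rfl, by simp; omega, e2.trans e, ?_⟩
    intro x hx
    rcases List.mem_cons.1 hx with rfl | hx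
    · exact hc
    · exact hu x hx
  have hvr : v.length < r := by simp at hlr; omega
  obtain ⟨p, q, hp, hq, epq⟩ := rank2 hd hdiag hoff hsym hij u hu hr2.suffix ha2.suffix
  intro k
  have p1 := ih _ hvr v i rfl hr2.pre (hasc i (Or.inl rfl)) k
  have p2 := ih _ hvr v j rfl hr2.pre (hasc j (Or.inr rfl)) k
  rw [← e, LP_append, Module.End.mul_apply, epq]
  simp only [map_add, map_smul, Pi.add_apply, Pi.smul_apply, smul_eq_mul]
  positivity

lemma wprod_eq (l : List (Fin n)) : wprod n d A l = LP n d A l.reverse := by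
  simp [wprod, LP, List.map_reverse]

lemma LP_rev (hd : ∀ i, 0 < d i) (hdiag : ∀ i, A i i = 2) (l : List (Fin n)) :
    LP n d A l * LP n d A l.reverse = 1 := by
  induction l with
  | nil => simp [LP_nil]
  | cons c l ih =>
    rw [List.reverse_cons, LP_append, LP_cons, LP_cons, LP_nil, mul_one, mul_assoc,
      ← mul_assoc (LP n d A l), ih, one_mul, refl_sq hd hdiag]

lemma rev_inj (hd : ∀ i, 0 < d i) (hdiag : ∀ i, A i i = 2) {l l' : List (Fin n)}
    (h : LP n d A l = LP n d A l') : LP n d A l.reverse = LP n d A l'.reverse := by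
  have h1 := LP_rev hd hdiag l'
  have h2 := LP_rev hd hdiag l.reverse
  rw [List.reverse_reverse, h] at h2
  calc _ = LP n d A l.reverse * (LP n d A l' * LP n d A l'.reverse) := by rw [h1, mul_one]
    _ = _ := by rw [← mul_assoc, h2, one_mul]

lemma red_of_len (hd : ∀ i, 0 < d i) (hdiag : ∀ i, A i i = 2) {l : List (Fin n)}
    (h : len n d A (wprod n d A l) = l.length) : Red n d A l := by
  intro l' hl'
  rw [← h]
  exact Nat.sInf_le ⟨l', rfl, by rw [wprod_eq, wprod_eq, rev_inj hd hdiag hl']⟩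

lemma form_inv (hd : ∀ i, 0 < d i) (hdiag : ∀ i, A i i = 2)
    (hsym : ∀ i j, d i * A i j = d j * A j i) (i : Fin n) (x y : Fin n → ℝ) :
    formL n d A (simpleRefl n d A i x) y = formL n d A x (simpleRefl n d A i y) := by
  rw [refl_apply, refl_apply]
  simp only [map_sub, map_smul, LinearMap.sub_apply, LinearMap.smul_apply, coF, smul_eq_mul]
  rw [formL_symm n d A hsym x (sroot n i)]
  ring

lemma form_adj (hd : ∀ i, 0 < d i) (hdiag : ∀ i, A i i = 2)
    (hsym : ∀ i j, d i * A i j = d j * A j i) (l : List (Fin n)) (x y : Fin n → ℝ) :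
    formL n d A (LP n d A l x) y = formL n d A x (LP n d A l.reverse y) := by
  induction l generalizing y with
  | nil => rfl
  | cons c l ih =>
    rw [LP_cons, Module.End.mul_apply, form_inv hd hdiag hsym, ih, List.reverse_cons, LP_append,
      LP_cons, LP_nil, mul_one, Module.End.mul_apply]

lemma LP_coord (l : List (Fin n)) (t : Fin n) (ht : t ∉ l) (x : Fin n → ℝ) :
    LP n d A l x t = x t := by
  induction l with
  | nil => rfl
  | cons c l ih =>
    simp only [List.mem_cons, not_or] at ht
    rw [LP_cons, Module.End.mul_apply, refl_apply]
    simp [sroot, Pi.single_apply, ht.1, ih ht.2]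

end

/-- in a rank `n+1` Cartan matrix where the extra node `n+1`
satisfies `A_{i,n+1} A_{n+1,i} ≥ 4` for all `i ≤ n` (so `s i s_{n+1}` has infinite
order), if `i_1, …, i_r ∈ {1, …, n}` and `ℓ(s i_r ⋯ s i_1) = r`, then
`s i_r ⋯ s i_1 (α_{n+1})` is a positive expression; in particular the resulting
vector is a positive root. -/
theorem stmt11 (n : ℕ) (hn : 1 ≤ n)
    (d : Fin (n + 1) → ℤ) (A : Fin (n + 1) → Fin (n + 1) → ℤ)
    (hd : ∀ i, 0 < d i) (hdiag : ∀ i, A i i = 2)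
    (hoff : ∀ i j, i ≠ j → A i j ≤ 0)
    (hsym : ∀ i j, d i * A i j = d j * A j i)
    (hinf : ∀ i : Fin n, 4 ≤ A i.castSucc (Fin.last n) * A (Fin.last n) i.castSucc)
    (l : List (Fin n))
    (hred : len (n + 1) d A (wprod (n + 1) d A (l.map Fin.castSucc)) = l.length) :
    IsPosExpr (n + 1) d A (Fin.last n) (l.map Fin.castSucc) ∧
      IsPosRoot (n + 1) d A
        (wprod (n + 1) d A (l.map Fin.castSucc) (sroot (n + 1) (Fin.last n))) := by
  set L := l.map Fin.castSucc with hL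
  have hr : Red (n + 1) d A L := red_of_len hd hdiag (by rw [hred, hL, List.length_map])
  have hlast : Fin.last n ∉ L := by
    simp only [hL, List.mem_map, not_exists, not_and]
    intro x _ h
    exact (Fin.castSucc_lt_last x).ne h
  have hexpr : IsPosExpr (n + 1) d A (Fin.last n) L := by
    intro k
    obtain ⟨k, hk⟩ := k
    simp only [List.get_eq_getElem]
    have htake : L.take (k + 1) = L.take k ++ [L[k]] := by simp
    set v := L.take k with hv
    set c := L[k] with hc
    have hcl : c ≠ Fin.last n := fun h => hlast (h ▸ List.getElem_mem hk)
    have hvlast : Fin.last n ∉ v := fun h => hlast (List.mem_of_mem_take h)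
    have hr1 : Red (n + 1) d A (v ++ [c]) := by
      have : L = (v ++ [c]) ++ L.drop (k + 1) := by rw [← htake, List.take_append_drop]
      rw [this] at hr
      exact hr.pre
    have hasc : Asc (n + 1) d A v c := by
      intro l' hl'
      have := hr1 l' (by rw [hl', LP_append, LP_cons, LP_nil, mul_one])
      simp at this; omega
    set y := LP (n + 1) d A v (sroot (n + 1) c) with hy
    have hpos : ∀ t, 0 ≤ y t := tits hd hdiag hoff hsym _ v c rfl hr1.pre hasc
    have hyl : y (Fin.last n) = 0 := by
      rw [hy, LP_coord _ _ hvlast]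
      simp [sroot, Pi.single_apply, hcl.symm]
    have hy0 : ∃ t, 0 < y t := by
      by_contra hcon
      push Not at hcon
      have hz : y = 0 := by
        ext t; exact le_antisymm (hcon t) (hpos t)
      have h1 : LP (n + 1) d A v.reverse y = sroot (n + 1) c := by
        rw [hy, ← Module.End.mul_apply]
        have := LP_rev hd hdiag (A := A) v.reverse
        rw [List.reverse_reverse] at this
        rw [this, Module.End.one_apply]
      rw [hz, map_zero] at h1
      have := congrFun h1 c
      simp [sroot] at this
    have hneg : formL (n + 1) d A y (sroot (n + 1) (Fin.last n)) < 0 := by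
      have hA : ∀ t, t ≠ Fin.last n → A t (Fin.last n) < 0 := by
        intro t ht
        have h1 := hoff t _ ht
        have h2 := hinf (t.castPred ht)
        simp only [Fin.castSucc_castPred] at h2
        rcases h1.lt_or_eq with h | h
        · exact h
        · rw [h] at h2; norm_num at h2
      have hterm : ∀ t, t ≠ Fin.last n → ((d t * A t (Fin.last n) : ℤ) : ℝ) < 0 := by
        intro t ht
        have := mul_neg_of_pos_of_neg (hd t) (hA t ht)
        exact_mod_cast this
      have heq : formL (n + 1) d A y (sroot (n + 1) (Fin.last n)) =
          ∑ t, ((d t * A t (Fin.last n) : ℤ) : ℝ) * y t := by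
        rw [formL_apply]
        simp [sroot, Pi.single_apply]
      rw [heq]
      refine Finset.sum_neg' (fun t _ => ?_) ?_
      · by_cases ht : t = Fin.last n
        · rw [ht, hyl]; simp
        · exact mul_nonpos_of_nonpos_of_nonneg (hterm t ht).le (hpos t)
      · obtain ⟨t, ht⟩ := hy0
        refine ⟨t, Finset.mem_univ _, mul_neg_of_neg_of_pos (hterm t ?_) ht⟩
        rintro rfl
        rw [hyl] at ht; exact lt_irrefl _ ht
    rw [hy, form_adj hd hdiag hsym] at hneg
    have hdc : (0:ℝ) < d c := by exact_mod_cast hd c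
    refine ⟨-coF (n + 1) d A c (LP (n + 1) d A v.reverse (sroot (n + 1) (Fin.last n))), ?_, ?_⟩
    · have : coF (n + 1) d A c (LP (n + 1) d A v.reverse (sroot (n + 1) (Fin.last n))) < 0 := by
        rw [coF, LinearMap.smul_apply, smul_eq_mul]
        exact mul_neg_of_pos_of_neg (inv_pos.2 hdc) hneg
      linarith
    · rw [htake, wprod_eq, wprod_eq, List.reverse_append, List.reverse_singleton,
        List.singleton_append, LP_cons, Module.End.mul_apply, refl_apply]
      module
  refine ⟨hexpr, ⟨L, Fin.last n, rfl⟩, ?_⟩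
  have hind : ∀ k, k ≤ L.length → ∀ t,
      0 ≤ wprod (n + 1) d A (L.take k) (sroot (n + 1) (Fin.last n)) t := by
    intro k
    induction k with
    | zero =>
      intro _ t
      simp only [List.take_zero, wprod_eq, List.reverse_nil, LP_nil, Module.End.one_apply, sroot,
        Pi.single_apply]
      split <;> simp
    | succ k ih =>
      intro hk t
      obtain ⟨c, hc, e⟩ := hexpr ⟨k, hk⟩
      have h1 := ih (by omega) t
      have h2 := congrFun e t
      have h3 : 0 ≤ (c • sroot (n + 1) (L.get ⟨k, hk⟩)) t := by
        simp only [Pi.smul_apply, sroot, Pi.single_apply, smul_eq_mul]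
        split <;> simp [hc.le]
      rw [← h2] at h3
      simp only [Pi.sub_apply] at h3
      linarith
  have := hind L.length le_rfl
  rwa [List.take_length] at this

end
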